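/- Let L be a finite relational language, n ≥ 1, L_c be L extended with constant symbols c₁,…,c_n, and L_P be L extended with n fresh unary relation symbols P₁,…,P_n. Let F be a finite set of finite nonempty L_c-structures. Then coCSP(F) is FO-definable (by an L_c-sentence over finite nonempty L_c-structures) if and only if there exists a subset F′ ⊆ F such that (i) coCSP(B^c) is FO-definable (by an L_P-sentence over finite nonempty L_P-structures) for every B ∈ F′, and (ii) for every B ∈ F there exists B′ ∈ F′ with an L_c-homomorphism from B to B′. -/

import Mathlib

open FirstOrder

/-- The relational language with `n` unary relation symbols `P₁, …, Pₙ`. -/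
def unaryLang (n : ℕ) : Language where
  Functions := fun _ => Empty
  Relations := fun l => match l with
    | 1 => Fin n
    | _ => Empty

/-- The structure for `unaryLang n` on `β` in which `Pᵢ` is interpreted by `P i`. -/
def unaryStructure {n : ℕ} {β : Type*} (P : Fin n → β → Prop) : (unaryLang n).Structure β where
  funMap := fun {_} f _ => f.elim
  RelMap := fun {l} r x =>
    match l, r, x with
    | 1, i, x => P i (x 0)

/-- Given an `L[[Fin n]]`-structure `B`, the structure `B^c` over the language `L_P`
(`L` extended with `n` fresh unary relation symbols `P₁, …, Pₙ`): the symbols of `L`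
are interpreted as in `B`, and `Pᵢ` is interpreted as the singleton `{cᵢ^B}`. -/
def ccStruct (L : Language) (n : ℕ) (β : Type*) [(L[[Fin n]]).Structure β] :
    (L.sum (unaryLang n)).Structure β :=
  letI : L.Structure β := (L.lhomWithConstants (Fin n)).reduct β
  letI : (unaryLang n).Structure β :=
    unaryStructure (fun i b =>
      b = Language.Structure.funMap (L := L[[Fin n]]) (M := β) (L.con i) Fin.elim0)
  Language.sumStructure L (unaryLang n) β

/-- Interpretation of an `L`-relation in an `L_c`-structure. -/
def relC {L : Language} {n : ℕ} {D : Type} [(L[[Fin n]]).Structure D] {l : ℕ}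
    (R : L.Relations l) (x : Fin l → D) : Prop :=
  Language.Structure.RelMap (L := L[[Fin n]]) (Sum.inl R) x

/-- Interpretation of a constant in an `L_c`-structure. -/
def conC (L : Language) {n : ℕ} (D : Type) [(L[[Fin n]]).Structure D] (i : Fin n) : D :=
  Language.Structure.funMap (L := L[[Fin n]]) (M := D) (L.con i) Fin.elim0

/-- Interpretation of an `L`-relation in an `L_P`-structure. -/
def relP {L : Language} {n : ℕ} {D : Type} [(L.sum (unaryLang n)).Structure D] {l : ℕ}
    (R : L.Relations l) (x : Fin l → D) : Prop :=
  Language.Structure.RelMap (L := L.sum (unaryLang n)) (Sum.inl R) x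

/-- An `L`-relation symbol as a symbol of `L_P`. -/
def symR {L : Language} (n : ℕ) {l : ℕ} (R : L.Relations l) :
    (L.sum (unaryLang n)).Relations l :=
  Sum.inl R

/-- The symbol `Pᵢ` of `L_P`. -/
def symP (L : Language) {n : ℕ} (i : Fin n) : (L.sum (unaryLang n)).Relations 1 :=
  Sum.inr i

/-- Interpretation of `Pᵢ` in an `L_P`-structure. -/
def unP (L : Language) {n : ℕ} {D : Type} [(L.sum (unaryLang n)).Structure D]
    (i : Fin n) (d : D) : Prop :=
  Language.Structure.RelMap (symP L i) (fun _ => d)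

section Homs

variable {L : Language} [L.IsRelational] {n : ℕ}

/-- Build an `L_c`-homomorphism. -/
def mkHomC {A B : Type} [(L[[Fin n]]).Structure A] [(L[[Fin n]]).Structure B] (f : A → B)
    (hr : ∀ {l : ℕ} (R : L.Relations l) (x : Fin l → A),
      relC (n := n) R x → relC (n := n) R (f ∘ x))
    (hc : ∀ i : Fin n, f (conC L A i) = conC L B i) : Language.Hom (L[[Fin n]]) A B where
  toFun := f
  map_fun' := by
    intro l g x
    rcases g with g | g
    · exact isEmptyElim g
    · cases l with
      | zero =>
        have h := hc g
        have hx : x = Fin.elim0 := Subsingleton.elim _ _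
        have hy : f ∘ x = Fin.elim0 := Subsingleton.elim _ _
        rw [hy, hx]
        exact h
      | succ l => exact PEmpty.elim g
  map_rel' := by
    intro l R x h
    rcases R with R | R
    · exact hr R x h
    · exact Empty.elim R

theorem homC_rel {A B : Type} [(L[[Fin n]]).Structure A] [(L[[Fin n]]).Structure B]
    (f : Language.Hom (L[[Fin n]]) A B) {l : ℕ} (R : L.Relations l) (x : Fin l → A)
    (h : relC (n := n) R x) : relC (n := n) R (f ∘ x) :=
  f.map_rel' _ x h

theorem homC_con {A B : Type} [(L[[Fin n]]).Structure A] [(L[[Fin n]]).Structure B]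
    (f : Language.Hom (L[[Fin n]]) A B) (i : Fin n) : f (conC L A i) = conC L B i := by
  have h := f.map_fun' (L.con i) Fin.elim0
  refine h.trans ?_
  have hy : f.toFun ∘ Fin.elim0 = Fin.elim0 := Subsingleton.elim _ _
  rw [hy]
  rfl

theorem cc_relP {A : Type} [(L[[Fin n]]).Structure A] {l : ℕ} (R : L.Relations l)
    (x : Fin l → A) :
    @relP L n A (ccStruct L n A) l R x ↔ relC (n := n) R x := Iff.rfl

theorem cc_unP {A : Type} [(L[[Fin n]]).Structure A] (i : Fin n) (a : A) :
    @unP L n A (ccStruct L n A) i a ↔ a = conC L A i := Iff.rfl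

/-- Build an `L_P`-homomorphism. -/
def mkHomP {A B : Type} [(L.sum (unaryLang n)).Structure A]
    [(L.sum (unaryLang n)).Structure B] (f : A → B)
    (hr : ∀ {l : ℕ} (R : L.Relations l) (x : Fin l → A),
      relP (n := n) R x → relP (n := n) R (f ∘ x))
    (hc : ∀ (i : Fin n) (a : A), unP L i a → unP L i (f a)) :
    Language.Hom (L.sum (unaryLang n)) A B where
  toFun := f
  map_fun' := by
    intro l g x
    rcases g with g | g
    · exact isEmptyElim g
    · exact Empty.elim g
  map_rel' := by
    intro l R x h
    rcases R with R | R
    · exact hr R x h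
    · match l, R, x, h with
      | 0, R, _, _ => exact Empty.elim R
      | 1, R, x, h =>
        have hx : x = fun _ => x 0 := by
          funext i
          rw [Subsingleton.elim i 0]
        rw [hx] at h ⊢
        exact hc R (x 0) h
      | (l + 2), R, _, _ => exact Empty.elim R

theorem homP_rel {A B : Type} [(L.sum (unaryLang n)).Structure A]
    [(L.sum (unaryLang n)).Structure B]
    (f : Language.Hom (L.sum (unaryLang n)) A B) {l : ℕ} (R : L.Relations l) (x : Fin l → A)
    (h : relP (n := n) R x) : relP (n := n) R (f ∘ x) :=
  f.map_rel' _ x h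

theorem homP_un {A B : Type} [(L.sum (unaryLang n)).Structure A]
    [(L.sum (unaryLang n)).Structure B]
    (f : Language.Hom (L.sum (unaryLang n)) A B) (i : Fin n) (a : A)
    (h : unP L i a) : unP L i (f a) :=
  f.map_rel' (symP L i) (fun _ => a) h

/-- `L_c`-homomorphisms `A → B` and `L_P`-homomorphisms `A^c → B^c` are the same. -/
theorem homC_iff_homP {A B : Type} [(L[[Fin n]]).Structure A] [(L[[Fin n]]).Structure B] :
    Nonempty (Language.Hom (L[[Fin n]]) A B) ↔
      Nonempty (@Language.Hom (L.sum (unaryLang n)) A B (ccStruct L n A) (ccStruct L n B)) := by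
  let _ := ccStruct L n A
  let _ := ccStruct L n B
  constructor
  · rintro ⟨f⟩
    refine ⟨mkHomP f (fun R x h => homC_rel f R x h) ?_⟩
    intro i a h
    rw [cc_unP] at h ⊢
    rw [h, homC_con]
  · rintro ⟨f⟩
    refine ⟨mkHomC f (fun R x h => homP_rel f R x h) ?_⟩
    intro i
    have := homP_un f i (conC L A i) ((cc_unP _ _).2 rfl)
    rwa [cc_unP] at this

end Homs

section Backward

variable {L : Language} [L.IsRelational] {n : ℕ}

/-- Terms of `L_P` are variables. -/
theorem termP_var {γ : Type} (t : (L.sum (unaryLang n)).Term γ) :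
    ∃ a, t = Language.Term.var a := by
  cases t with
  | var a => exact ⟨a, rfl⟩
  | func f _ =>
    rcases f with f | f
    · exact isEmptyElim f
    · exact Empty.elim f

/-- Translation of `L_P`-formulas to `L_c`-formulas along `D ↦ D^c`. -/
theorem translateP {k : ℕ} (ψ : (L.sum (unaryLang n)).BoundedFormula Empty k) :
    ∃ φ : (L[[Fin n]]).BoundedFormula Empty k,
      ∀ (D : Type) [(L[[Fin n]]).Structure D] (v : Empty → D) (x : Fin k → D),
        φ.Realize v x ↔
          @Language.BoundedFormula.Realize _ D (ccStruct L n D) _ _ ψ v x := by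
  induction ψ with
  | falsum => exact ⟨.falsum, fun D _ v x => Iff.rfl⟩
  | equal t₁ t₂ =>
    obtain ⟨a, rfl⟩ := termP_var t₁
    obtain ⟨b, rfl⟩ := termP_var t₂
    exact ⟨.equal (.var a) (.var b), fun D _ v x => Iff.rfl⟩
  | @rel k l R ts =>
    choose a ha using fun i => termP_var (ts i)
    obtain rfl : ts = fun i => Language.Term.var (a i) := funext ha
    rcases R with R | R
    · exact ⟨.rel (Sum.inl R : (L[[Fin n]]).Relations l) (fun i => .var (a i)),
        fun D _ v x => Iff.rfl⟩
    · match l, R, a with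
      | 0, R, _ => exact Empty.elim R
      | 1, R, a =>
        exact ⟨.equal (.var (a 0)) (.func (L.con (R : Fin n)) Fin.elim0), fun D _ v x => by
          have h : (fun i : Fin 0 => Language.Term.realize (L := L[[Fin n]]) (Sum.elim v x)
            (Fin.elim0 i)) = Fin.elim0 := Subsingleton.elim _ _
          simp only [Language.BoundedFormula.Realize, Language.Term.realize]
          rw [h]
          exact Iff.rfl⟩
      | (l + 2), R, _ => exact Empty.elim R
  | imp f₁ f₂ ih₁ ih₂ =>
    obtain ⟨g₁, h₁⟩ := ih₁
    obtain ⟨g₂, h₂⟩ := ih₂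
    exact ⟨g₁.imp g₂, fun D _ v x => imp_congr (h₁ D v x) (h₂ D v x)⟩
  | all f ih =>
    obtain ⟨g, h⟩ := ih
    exact ⟨g.all, fun D _ v x => forall_congr' fun d => h D v _⟩

end Backward

section Definability

variable {L : Language} {n : ℕ}

/-- A uniform family of predicates on `L_P`-structures is first-order definable. -/
def FODef (L : Language) (n : ℕ) (α : Type)
    (Q : ∀ (D : Type) [(L.sum (unaryLang n)).Structure D], (α → D) → Prop) : Prop :=
  ∃ ψ : (L.sum (unaryLang n)).Formula α,
    ∀ (D : Type) [(L.sum (unaryLang n)).Structure D] (x : α → D), ψ.Realize x ↔ Q D x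

variable {α : Type}
  {Q Q' : ∀ (D : Type) [(L.sum (unaryLang n)).Structure D], (α → D) → Prop}

theorem FODef.congr (h : FODef L n α Q)
    (e : ∀ (D : Type) [(L.sum (unaryLang n)).Structure D] (x : α → D), Q' D x ↔ Q D x) :
    FODef L n α Q' := by
  obtain ⟨ψ, hψ⟩ := h
  exact ⟨ψ, fun D _ x => (hψ D x).trans (e D x).symm⟩

theorem FODef.const (p : Prop) : FODef L n α (fun _ _ _ => p) := by
  by_cases h : p
  · exact ⟨⊤, fun D _ x => by simp [h]⟩
  · exact ⟨⊥, fun D _ x => by simp [h]⟩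

theorem FODef.imp (h : FODef L n α Q) (h' : FODef L n α Q') :
    FODef L n α (fun D _ x => Q D x → Q' D x) := by
  obtain ⟨ψ, hψ⟩ := h
  obtain ⟨ψ', hψ'⟩ := h'
  exact ⟨ψ.imp ψ', fun D _ x => by rw [Language.Formula.realize_imp, hψ, hψ']⟩

theorem FODef.and (h : FODef L n α Q) (h' : FODef L n α Q') :
    FODef L n α (fun D _ x => Q D x ∧ Q' D x) := by
  obtain ⟨ψ, hψ⟩ := h
  obtain ⟨ψ', hψ'⟩ := h'
  exact ⟨ψ ⊓ ψ', fun D _ x => by rw [Language.Formula.realize_inf, hψ, hψ']⟩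

theorem FODef.or (h : FODef L n α Q) (h' : FODef L n α Q') :
    FODef L n α (fun D _ x => Q D x ∨ Q' D x) := by
  obtain ⟨ψ, hψ⟩ := h
  obtain ⟨ψ', hψ'⟩ := h'
  exact ⟨ψ ⊔ ψ', fun D _ x => by rw [Language.Formula.realize_sup, hψ, hψ']⟩

theorem FODef.forallIdx {β : Type} [Finite β]
    {Q : β → ∀ (D : Type) [(L.sum (unaryLang n)).Structure D], (α → D) → Prop}
    (h : ∀ b, FODef L n α (Q b)) : FODef L n α (fun D _ x => ∀ b, Q b D x) := by
  choose ψ hψ using h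
  exact ⟨Language.Formula.iInf ψ, fun D _ x => by
    rw [Language.Formula.realize_iInf]
    exact forall_congr' fun b => hψ b D x⟩

theorem FODef.existsIdx {β : Type} [Finite β]
    {Q : β → ∀ (D : Type) [(L.sum (unaryLang n)).Structure D], (α → D) → Prop}
    (h : ∀ b, FODef L n α (Q b)) : FODef L n α (fun D _ x => ∃ b, Q b D x) := by
  choose ψ hψ using h
  exact ⟨Language.Formula.iSup ψ, fun D _ x => by
    rw [Language.Formula.realize_iSup]
    exact exists_congr fun b => hψ b D x⟩

theorem FODef.forallTuple {β : Type} [Finite β]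
    {Q : ∀ (D : Type) [(L.sum (unaryLang n)).Structure D], (α ⊕ β → D) → Prop}
    (h : FODef L n (α ⊕ β) Q) :
    FODef L n α (fun D _ x => ∀ y : β → D, Q D (Sum.elim x y)) := by
  obtain ⟨ψ, hψ⟩ := h
  exact ⟨ψ.iAlls β, fun D _ x => by
    rw [Language.Formula.realize_iAlls]
    exact forall_congr' fun b => hψ D _⟩

theorem FODef.existsTuple {β : Type} [Finite β]
    {Q : ∀ (D : Type) [(L.sum (unaryLang n)).Structure D], (α ⊕ β → D) → Prop}
    (h : FODef L n (α ⊕ β) Q) :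
    FODef L n α (fun D _ x => ∃ y : β → D, Q D (Sum.elim x y)) := by
  obtain ⟨ψ, hψ⟩ := h
  exact ⟨ψ.iExs β, fun D _ x => by
    rw [Language.Formula.realize_iExs]
    exact exists_congr fun b => hψ D _⟩

theorem FODef.eq (a b : α) : FODef L n α (fun D _ x => x a = x b) :=
  ⟨Language.Term.equal (.var a) (.var b), fun D _ x => by
    rw [Language.Formula.realize_equal]; rfl⟩

theorem FODef.relP {l : ℕ} (R : L.Relations l) (a : Fin l → α) :
    FODef L n α (fun D _ x => _root_.relP (n := n) R (fun i => x (a i))) :=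
  ⟨Language.Relations.formula (symR n R) (fun i => .var (a i)),
    fun D _ x => by rw [Language.Formula.realize_rel]; rfl⟩

theorem FODef.unP (i : Fin n) (a : α) :
    FODef L n α (fun D _ x => _root_.unP L i (x a)) :=
  ⟨Language.Relations.formula (symP L i) (fun _ => .var a),
    fun D _ x => by rw [Language.Formula.realize_rel]; rfl⟩

end Definability

section Glue

variable (L : Language) (n : ℕ) (B : Type) [(L[[Fin n]]).Structure B]

/-- `y` is in `Pᵢ` in the disjoint union `D ⊔ B^c`. -/
def inP (D : Type) [(L.sum (unaryLang n)).Structure D] (i : Fin n) : D ⊕ B → Prop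
  | .inl d => unP L i d
  | .inr b => b = conC L B i

/-- The indices `i` and `j` are linked by overlapping `P`s. -/
def linked (D : Type) [(L.sum (unaryLang n)).Structure D] (i j : Fin n) : Prop :=
  ∀ r : Set (Fin n × Fin n), ((∀ a, (a, a) ∈ r) ∧ (∀ a b, (a, b) ∈ r → (b, a) ∈ r) ∧
    (∀ a b c, (a, b) ∈ r → (b, c) ∈ r → (a, c) ∈ r)) →
    (∀ a b, (∃ y, inP L n B D a y ∧ inP L n B D b y) → (a, b) ∈ r) → (i, j) ∈ r

/-- The gluing equivalence relation on `D ⊔ B`. -/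
def glueRel (D : Type) [(L.sum (unaryLang n)).Structure D] (y z : D ⊕ B) : Prop :=
  y = z ∨ ∃ i j, inP L n B D i y ∧ inP L n B D j z ∧ linked L n B D i j

/-- The gluing setoid. -/
def glueSetoid (D : Type) [(L.sum (unaryLang n)).Structure D] : Setoid (D ⊕ B) where
  r := glueRel L n B D
  iseqv := by
    refine ⟨fun y => Or.inl rfl, ?_, ?_⟩
    · rintro y z (rfl | ⟨i, j, hi, hj, h⟩)
      · exact Or.inl rfl
      · exact Or.inr ⟨j, i, hj, hi, fun r hr h' => hr.2.1 _ _ (h r hr h')⟩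
    · rintro x y z (rfl | ⟨i, j, hi, hj, h⟩) (rfl | ⟨i', j', hi', hj', h'⟩)
      · exact Or.inl rfl
      · exact Or.inr ⟨i', j', hi', hj', h'⟩
      · exact Or.inr ⟨i, j, hi, hj, h⟩
      · refine Or.inr ⟨i, j', hi, hj', fun r hr hh => ?_⟩
        exact hr.2.2 _ _ _ (h r hr hh)
          (hr.2.2 _ _ _ (hh j i' ⟨y, hj, hi'⟩) (h' r hr hh))

/-- The glued structure. -/
def Glue (D : Type) [(L.sum (unaryLang n)).Structure D] : Type :=
  Quotient (glueSetoid L n B D)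

/-- The projection to the glued structure. -/
def gmk (D : Type) [(L.sum (unaryLang n)).Structure D] (y : D ⊕ B) : Glue L n B D :=
  Quotient.mk (glueSetoid L n B D) y

theorem gmk_eq (D : Type) [(L.sum (unaryLang n)).Structure D] (y z : D ⊕ B) :
    gmk L n B D y = gmk L n B D z ↔ glueRel L n B D y z :=
  Quotient.eq (r := glueSetoid L n B D)

/-- An `L`-relation on the glued structure. -/
def glueR (D : Type) [(L.sum (unaryLang n)).Structure D] {l : ℕ} (R : L.Relations l)
    (x : Fin l → Glue L n B D) : Prop :=
  (∃ y : Fin l → D, relP (n := n) R y ∧ ∀ j, gmk L n B D (.inl (y j)) = x j) ∨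
  (∃ y : Fin l → B, relC (n := n) R y ∧ ∀ j, gmk L n B D (.inr (y j)) = x j)

variable [L.IsRelational]

instance glueStructure (D : Type) [(L.sum (unaryLang n)).Structure D] :
    (L[[Fin n]]).Structure (Glue L n B D) :=
  letI : L.Structure (Glue L n B D) :=
    { funMap := fun f _ => isEmptyElim f
      RelMap := fun R x => glueR L n B D R x }
  letI : (Language.constantsOn (Fin n)).Structure (Glue L n B D) :=
    Language.constantsOn.structure (fun i => gmk L n B D (.inr (conC L B i)))
  Language.sumStructure L (Language.constantsOn (Fin n)) (Glue L n B D)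

theorem glue_relC (D : Type) [(L.sum (unaryLang n)).Structure D] {l : ℕ} (R : L.Relations l)
    (x : Fin l → Glue L n B D) : relC (n := n) R x ↔ glueR L n B D R x := Iff.rfl

theorem glue_conC (D : Type) [(L.sum (unaryLang n)).Structure D] (i : Fin n) :
    conC L (Glue L n B D) i = gmk L n B D (.inr (conC L B i)) := rfl

/-- `B` maps to the glued structure. -/
theorem glue_hom_right (D : Type) [(L.sum (unaryLang n)).Structure D] :
    Nonempty (Language.Hom (L[[Fin n]]) B (Glue L n B D)) :=
  ⟨mkHomC (fun b => gmk L n B D (.inr b))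
    (fun R x h => Or.inr ⟨x, h, fun _ => rfl⟩) (fun i => rfl)⟩

theorem linked_refl (D : Type) [(L.sum (unaryLang n)).Structure D] (i : Fin n) :
    linked L n B D i i := fun _ hr _ => hr.1 i

/-- `D` maps to the glued structure. -/
theorem glue_hom_left (D : Type) [(L.sum (unaryLang n)).Structure D] :
    Nonempty (@Language.Hom (L.sum (unaryLang n)) D (Glue L n B D) _
      (ccStruct L n (Glue L n B D))) := by
  let _ := ccStruct L n (Glue L n B D)
  refine ⟨mkHomP (fun d => gmk L n B D (.inl d))
    (fun R x h => Or.inl ⟨x, h, fun _ => rfl⟩) ?_⟩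
  intro i d h
  rw [cc_unP, glue_conC, gmk_eq]
  exact Or.inr ⟨i, i, h, rfl, linked_refl L n B D i⟩

/-- The universal property, with target `B`. -/
theorem glue_hom_desc (D : Type) [(L.sum (unaryLang n)).Structure D]
    (f : @Language.Hom (L.sum (unaryLang n)) D B _ (ccStruct L n B)) :
    Nonempty (Language.Hom (L[[Fin n]]) (Glue L n B D) B) := by
  let _ := ccStruct L n B
  have hP : ∀ i y, inP L n B D i y → Sum.elim f id y = conC L B i := by
    rintro i (d | b) h
    · exact (cc_unP i (f d)).1 (homP_un f i d h)
    · exact h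
  let g : Glue L n B D → B := Quotient.lift (s := glueSetoid L n B D) (Sum.elim f id) (by
    rintro y z (rfl | ⟨i, j, hi, hj, h⟩)
    · rfl
    · rw [hP i y hi, hP j z hj]
      refine h {p | conC L B p.1 = conC L B p.2} ⟨fun _ => rfl, fun _ _ h => h.symm,
        fun _ _ _ h h' => h.trans h'⟩ ?_
      rintro a b ⟨y, ha, hb⟩
      exact (hP a y ha).symm.trans (hP b y hb))
  have hg : ∀ y, g (gmk L n B D y) = Sum.elim f id y := fun _ => rfl
  refine ⟨mkHomC g ?_ (fun i => rfl)⟩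
  rintro l R x (⟨y, hy, hyx⟩ | ⟨y, hy, hyx⟩)
  · have e : g ∘ x = f ∘ y := by
      funext j
      simp only [Function.comp, ← hyx, hg, Sum.elim_inl]
    rw [e]
    exact homP_rel f R y hy
  · have e : g ∘ x = y := by
      funext j
      simp only [Function.comp, ← hyx, hg, Sum.elim_inr, id]
    rw [e]
    exact hy

end Glue

section GlueDef

variable (L : Language) {n : ℕ} (B : Type) [(L[[Fin n]]).Structure B] [Finite B]
variable {α : Type}

theorem inP_def (i : Fin n) (u : α ⊕ B) :
    FODef L n α (fun D _ x => inP L n B D i (Sum.map x id u)) := by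
  rcases u with a | b
  · exact FODef.unP i a
  · exact FODef.const _

theorem link_def (i j : Fin n) :
    FODef L n α (fun D _ _ => ∃ y, inP L n B D i y ∧ inP L n B D j y) := by
  have h1 : FODef L n α (fun D _ x => ∃ y : Unit → D,
      inP L n B D i (Sum.map (Sum.elim x y) id (.inl (.inr ()))) ∧
      inP L n B D j (Sum.map (Sum.elim x y) id (.inl (.inr ())))) :=
    FODef.existsTuple (Q := fun D _ z => inP L n B D i (Sum.map z id (.inl (.inr ()))) ∧
      inP L n B D j (Sum.map z id (.inl (.inr ()))))
      ((inP_def L B i _).and (inP_def L B j _))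
  have h2 : FODef L n α (fun D _ _ => ∃ b : B, b = conC L B i ∧ b = conC L B j) :=
    FODef.const _
  refine (h1.or h2).congr ?_
  intro D _ x
  constructor
  · rintro ⟨d | b, h⟩
    · exact Or.inl ⟨fun _ => d, h⟩
    · exact Or.inr ⟨b, h⟩
  · rintro (⟨y, h⟩ | ⟨b, h⟩)
    · exact ⟨.inl (y ()), h⟩
    · exact ⟨.inr b, h⟩

theorem linked_def (i j : Fin n) : FODef L n α (fun D _ _ => linked L n B D i j) :=
  FODef.forallIdx fun _ => (FODef.const _).imp <|
    (FODef.forallIdx fun a => FODef.forallIdx fun b => (link_def L B a b).imp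
      (FODef.const _)).imp (FODef.const _)

theorem gmk_eq_def (u w : α ⊕ B) :
    FODef L n α (fun D _ x => gmk L n B D (Sum.map x id u) = gmk L n B D (Sum.map x id w)) := by
  have h1 : FODef L n α (fun D _ x => Sum.map x (id : B → B) u = Sum.map x id w) := by
    rcases u with a | b <;> rcases w with a' | b'
    · exact (FODef.eq a a').congr fun D _ x => by simp
    · exact (FODef.const False).congr fun D _ x => by simp
    · exact (FODef.const False).congr fun D _ x => by simp
    · exact (FODef.const (b = b')).congr fun D _ x => by simp
  have h2 := FODef.existsIdx fun i : Fin n => FODef.existsIdx fun j : Fin n =>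
    (inP_def L B i u).and ((inP_def L B j w).and (linked_def L B (α := α) i j))
  exact (h1.or h2).congr fun D _ x => gmk_eq L n B D _ _

theorem glueR_def {l : ℕ} (R : L.Relations l) (u : Fin l → α ⊕ B) :
    FODef L n α (fun D _ x => glueR L n B D R (fun j => gmk L n B D (Sum.map x id (u j)))) := by
  have h1 := FODef.existsTuple (α := α) (β := Fin l) ((FODef.relP (n := n) R
    (fun j => (Sum.inr j : α ⊕ Fin l))).and
      (FODef.forallIdx fun j : Fin l => gmk_eq_def L B (.inl (.inr j))
        (Sum.map Sum.inl id (u j))))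
  have h2 := FODef.existsIdx fun y : Fin l → B =>
    (FODef.const (L := L) (n := n) (α := α) (relC (n := n) R y)).and
      (FODef.forallIdx fun j : Fin l => gmk_eq_def L B (.inr (y j)) (u j))
  refine (h1.or h2).congr ?_
  intro D _ x
  have e : ∀ (y : Fin l → D) j,
      Sum.map (Sum.elim x y) (id : B → B) (Sum.map Sum.inl id (u j)) = Sum.map x id (u j) := by
    intro y j
    rcases u j with a | b <;> rfl
  simp only [e]
  exact Iff.rfl

variable [L.IsRelational]

theorem term_glue {k : ℕ} (t : (L[[Fin n]]).Term (Empty ⊕ Fin k)) (w : Fin k → α ⊕ B) :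
    ∃ u : α ⊕ B, ∀ (D : Type) [(L.sum (unaryLang n)).Structure D] (v : Empty → Glue L n B D)
      (x : α → D),
      t.realize (Sum.elim v (fun i => gmk L n B D (Sum.map x id (w i)))) =
        gmk L n B D (Sum.map x id u) := by
  cases t with
  | var a =>
    rcases a with a | a
    · exact a.elim
    · exact ⟨w a, fun D _ v x => rfl⟩
  | @func l f ts =>
    rcases f with f | f
    · exact isEmptyElim f
    · cases l with
      | zero => exact ⟨.inr (conC L B f), fun D _ v x => rfl⟩
      | succ l => exact PEmpty.elim f

theorem translateC {k : ℕ} (φ : (L[[Fin n]]).BoundedFormula Empty k) :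
    ∀ (α : Type) (w : Fin k → α ⊕ B),
      FODef L n α (fun D _ x => φ.Realize (M := Glue L n B D) (fun e => e.elim)
        (fun i => gmk L n B D (Sum.map x id (w i)))) := by
  induction φ with
  | falsum => exact fun α w => FODef.const False
  | equal t₁ t₂ =>
    intro α w
    obtain ⟨u₁, h₁⟩ := term_glue L B t₁ w
    obtain ⟨u₂, h₂⟩ := term_glue L B t₂ w
    refine (gmk_eq_def L B u₁ u₂).congr ?_
    intro D _ x
    simp only [Language.BoundedFormula.Realize]
    rw [h₁, h₂]
  | @rel k l R ts =>
    intro α w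
    choose u hu using fun j => term_glue L B (ts j) w
    rcases R with R | R
    · refine (glueR_def L B R u).congr ?_
      intro D _ x
      simp only [Language.BoundedFormula.Realize]
      simp only [hu]
      exact Iff.rfl
    · exact Empty.elim R
  | imp f₁ f₂ ih₁ ih₂ => exact fun α w => (ih₁ α w).imp (ih₂ α w)
  | @all k f ih =>
    intro α w
    have h1 := FODef.forallTuple (ih (α ⊕ Unit)
      (Fin.snoc (α := fun _ => (α ⊕ Unit) ⊕ B) (fun i => Sum.map Sum.inl id (w i))
        (.inl (.inr ()))))
    have h2 := FODef.forallIdx fun b : B => ih α (Fin.snoc (α := fun _ => α ⊕ B) w (.inr b))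
    refine (h1.and h2).congr ?_
    intro D _ x
    have e1 : ∀ y : Unit → D, (fun i => gmk L n B D (Sum.map (Sum.elim x y) id
        (Fin.snoc (α := fun _ => (α ⊕ Unit) ⊕ B) (fun i => Sum.map Sum.inl id (w i))
        (.inl (.inr ())) i))) =
        Fin.snoc (α := fun _ => Glue L n B D) (fun i => gmk L n B D (Sum.map x id (w i)))
          (gmk L n B D (.inl (y ()))) := by
      intro y
      funext i
      refine Fin.lastCases ?_ (fun i => ?_) i
      · simp
      · simp only [Fin.snoc_castSucc]
        rcases w i with a | b <;> rfl
    have e2 : ∀ b : B, (fun i => gmk L n B D (Sum.map x id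
        (Fin.snoc (α := fun _ => α ⊕ B) w (.inr b) i))) =
        Fin.snoc (α := fun _ => Glue L n B D) (fun i => gmk L n B D (Sum.map x id (w i)))
          (gmk L n B D (.inr b)) := by
      intro b
      funext i
      refine Fin.lastCases ?_ (fun i => ?_) i
      · simp
      · simp only [Fin.snoc_castSucc]
    simp only [e1, e2, Language.BoundedFormula.realize_all]
    constructor
    · exact fun h => ⟨fun y => h _, fun b => h _⟩
    · rintro ⟨h, h'⟩ q
      obtain ⟨y, rfl⟩ : ∃ y, gmk L n B D y = q := Quotient.exists_rep q
      rcases y with d | b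
      · exact h fun _ => d
      · exact h' b

theorem translateC_sentence (φ : (L[[Fin n]]).Sentence) :
    ∃ ψ : (L.sum (unaryLang n)).Sentence,
      ∀ (D : Type) [(L.sum (unaryLang n)).Structure D], D ⊨ ψ ↔ Glue L n B D ⊨ φ := by
  obtain ⟨ψ, hψ⟩ := translateC L B φ Empty Fin.elim0
  refine ⟨ψ, fun D _ => (hψ D default).trans ?_⟩
  rw [Language.Sentence.Realize, Language.Formula.Realize]
  have key : ∀ (v v' : Empty → Glue L n B D) (x x' : Fin 0 → Glue L n B D),
      Language.BoundedFormula.Realize φ v x ↔ Language.BoundedFormula.Realize φ v' x' := by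
    intro v v' x x'
    rw [Subsingleton.elim v v', Subsingleton.elim x x']
  exact key _ _ _ _

end GlueDef

/-- Let `L` be a finite relational language, `n ≥ 1`, `L_c = L[[Fin n]]`,
and `L_P` the extension of `L` by `n` fresh unary relation symbols.  Let `F = {F i}` be a
finite set of finite nonempty `L_c`-structures.  Then `coCSP(F)` is FO-definable (by an
`L_c`-sentence over finite nonempty `L_c`-structures) iff there is a subset `s` of `F`
such that (i) `coCSP(B^c)` is FO-definable (by an `L_P`-sentence over finite nonempty
`L_P`-structures) for every `B ∈ s`, and (ii) every member of `F` admits an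
`L_c`-homomorphism to some member of `s`. -/
theorem coCSP_FODefinable_iff_exists_subfamily
    (L : Language) [L.IsRelational] [Finite L.Symbols] (n : ℕ) (hn : 1 ≤ n)
    (ι : Type) [Finite ι] (F : ι → Type)
    [∀ i, Finite (F i)] [∀ i, Nonempty (F i)] [∀ i, (L[[Fin n]]).Structure (F i)] :
    (∃ φ : (L[[Fin n]]).Sentence,
      ∀ (D : Type) [Finite D] [Nonempty D] [(L[[Fin n]]).Structure D],
        D ⊨ φ ↔ ∀ i, IsEmpty (Language.Hom (L[[Fin n]]) D (F i))) ↔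
    (∃ s : Set ι,
      (∀ i ∈ s, ∃ ψ : (L.sum (unaryLang n)).Sentence,
        ∀ (D : Type) [Finite D] [Nonempty D] [(L.sum (unaryLang n)).Structure D],
          D ⊨ ψ ↔
            IsEmpty (@Language.Hom (L.sum (unaryLang n)) D (F i) _ (ccStruct L n (F i)))) ∧
      (∀ i, ∃ j ∈ s, Nonempty (Language.Hom (L[[Fin n]]) (F i) (F j)))) := by
  constructor
  · rintro ⟨φ, hφ⟩
    refine ⟨{i | ∀ j, Nonempty (Language.Hom (L[[Fin n]]) (F i) (F j)) →
      Nonempty (Language.Hom (L[[Fin n]]) (F j) (F i))}, ?_, ?_⟩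
    · intro i hi
      obtain ⟨ψ, hψ⟩ := translateC_sentence L (F i) φ
      refine ⟨ψ, fun D _ _ _ => ?_⟩
      haveI : Finite (Glue L n (F i) D) :=
        Finite.of_surjective (gmk L n (F i) D) (fun q => Quotient.exists_rep q)
      haveI : Nonempty (Glue L n (F i) D) := ⟨gmk L n (F i) D (.inr (Classical.arbitrary _))⟩
      rw [hψ D, hφ (Glue L n (F i) D)]
      constructor
      · intro h
        refine ⟨fun f => ?_⟩
        obtain ⟨g⟩ := glue_hom_desc L n (F i) D f
        exact (h i).false g
      · intro h j
        refine ⟨fun g => ?_⟩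
        obtain ⟨b⟩ := glue_hom_right L n (F i) D
        obtain ⟨d⟩ := glue_hom_left L n (F i) D
        obtain ⟨r⟩ := hi j ⟨g.comp b⟩
        obtain ⟨s⟩ := homC_iff_homP.1 ⟨r.comp g⟩
        let _ := ccStruct L n (F i)
        let _ := ccStruct L n (Glue L n (F i) D)
        exact h.false (s.comp d)
    · intro i
      letI : Preorder ι :=
        { le := fun i j => Nonempty (Language.Hom (L[[Fin n]]) (F i) (F j))
          le_refl := fun i => ⟨Language.Hom.id _ _⟩
          le_trans := fun i j k ⟨f⟩ ⟨g⟩ => ⟨g.comp f⟩ }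
      obtain ⟨j, hij, hj⟩ := Set.Finite.exists_le_maximal (Set.toFinite (Set.univ : Set ι))
        (Set.mem_univ i)
      exact ⟨j, fun k hk => hj.2 (Set.mem_univ k) hk, hij⟩
  · rintro ⟨s, hs, hd⟩
    have key : ∀ i : s, ∃ φ : (L[[Fin n]]).Sentence,
        ∀ (D : Type) [Finite D] [Nonempty D] [(L[[Fin n]]).Structure D],
          D ⊨ φ ↔ IsEmpty (Language.Hom (L[[Fin n]]) D (F i)) := by
      intro i
      obtain ⟨ψ, hψ⟩ := hs i i.2
      obtain ⟨φ, hφ⟩ := translateP ψ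
      refine ⟨φ, fun D _ _ _ => (hφ D _ _).trans ?_⟩
      refine (@hψ D _ _ (ccStruct L n D)).trans ?_
      rw [← not_nonempty_iff, ← not_nonempty_iff, homC_iff_homP]
    choose φ hφ using key
    refine ⟨Language.Formula.iInf φ, fun D _ _ _ => ?_⟩
    have h1 : D ⊨ (Language.Formula.iInf φ : (L[[Fin n]]).Sentence) ↔ ∀ i, D ⊨ φ i :=
      Language.Formula.realize_iInf
    rw [h1]
    constructor
    · intro h i
      refine ⟨fun f => ?_⟩
      obtain ⟨j, hj, ⟨g⟩⟩ := hd i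
      exact ((hφ ⟨j, hj⟩ D).1 (h ⟨j, hj⟩)).false (g.comp f)
    · exact fun h i => (hφ i D).2 (h i)
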